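/- In the setting of the previous statement (unitary family W_θ on ℂ^D ⊗ ℂ^k, stationarity W_{θ0}(ψ⊗χ) = ψ⊗χ, Kraus operators K^[j]_i(θ) = ⟨e^[j]_i|W_θ|χ⟩ with K^[j]_i ψ = c^[j]_i ψ, c^[j]_i ≠ 0), suppose additionally that a final projective measurement {P_{i_0}}_{i_0=1}^D with rank-one projections P_{i_0} = |e^{s}_{i_0}⟩⟨e^{s}_{i_0}| onto an orthonormal basis of ℂ^D satisfying |⟨e^{s}_{i_0}, ψ⟩|² = 1/D is performed, so the augmented likelihood is p_θ(i_1,…,i_n,i_0) = ‖P_{i_0} K^[n]_{i_n}(θ)···K^[1]_{i_1}(θ)ψ‖². Then the classical Fisher information of the full record at θ0 equals Σ p_{θ0} f̃², where f̃(i_1,…,i_n,i_0) = 2D Re Σ_{j=1}^n ⟨ψ| P_{i_0} K^[n]_{i_n}···K^[j+1]_{i_{j+1}} K̇^[j]_{i_j} |ψ⟩ / (c^[j]_{i_j} ··· c^[n]_{i_n}). -/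

import Mathlib

open scoped BigOperators Matrix Kronecker ComplexConjugate Classical
open Matrix

noncomputable section

/-- Inner product on `ι → ℂ`, conjugate-linear in the first argument. -/
def inn {ι : Type*} [Fintype ι] (v w : ι → ℂ) : ℂ := ∑ i, conj (v i) * w i

/-- Squared norm on `ι → ℂ`. -/
def nsq {ι : Type*} [Fintype ι] (v : ι → ℂ) : ℝ := ∑ i, Complex.normSq (v i)

/-- Tensor product of two vectors. -/
def vtens {α β : Type*} (v : α → ℂ) (w : β → ℂ) : α × β → ℂ := fun p => v p.1 * w p.2

/-- Outer product `|v⟩⟨w|`. -/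
def outer {α : Type*} (v w : α → ℂ) : Matrix α α ℂ := fun x y => v x * conj (w y)

/-- Kraus operator `⟨e|W|χ⟩`. -/
def kraus {α ι : Type*} [Fintype ι] (W : Matrix (α × ι) (α × ι) ℂ) (e χ : ι → ℂ) :
    Matrix α α ℂ :=
  fun s t => ∑ u, ∑ v, conj (e u) * W (s, u) (t, v) * χ v

/-- `A (n-1) ⋯ A 1 A 0`. -/
def kprodFin {α : Type*} [Fintype α] [DecidableEq α] {n : ℕ} (A : Fin n → Matrix α α ℂ) :
    Matrix α α ℂ :=
  ((List.ofFn A).reverse).prod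

/-- `A (n-1) ⋯ A j`. -/
def kprodFrom {α : Type*} [Fintype α] [DecidableEq α] {n : ℕ} (A : Fin n → Matrix α α ℂ)
    (j : ℕ) : Matrix α α ℂ :=
  (((List.ofFn A).drop j).reverse).prod

theorem kprodFin_succ_last {α : Type*} [Fintype α] [DecidableEq α] {n : ℕ}
    (A : Fin (n + 1) → Matrix α α ℂ) :
    kprodFin A = A (Fin.last n) * kprodFin (fun j : Fin n => A j.castSucc) := by
  unfold kprodFin
  rw [List.ofFn_succ_last]
  simp

theorem kprodFrom_succ_last {α : Type*} [Fintype α] [DecidableEq α] {n : ℕ}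
    (A : Fin (n + 1) → Matrix α α ℂ) (j : Fin n) :
    kprodFrom A ((j : ℕ) + 1) =
      A (Fin.last n) * kprodFrom (fun j : Fin n => A j.castSucc) ((j : ℕ) + 1) := by
  unfold kprodFrom
  rw [List.ofFn_succ_last, List.drop_append_of_le_length (by simp)]
  simp

theorem kprodFrom_length {α : Type*} [Fintype α] [DecidableEq α] {n : ℕ}
    (A : Fin n → Matrix α α ℂ) :
    kprodFrom A n = 1 := by
  unfold kprodFrom
  rw [List.drop_of_length_le (by simp)]
  simp

theorem kprodFin_mulVec {α : Type*} [Fintype α] [DecidableEq α] {n : ℕ}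
    (A : Fin n → Matrix α α ℂ) (c : Fin n → ℂ) (ψ : α → ℂ)
    (h : ∀ j, (A j).mulVec ψ = c j • ψ) :
    (kprodFin A).mulVec ψ = (∏ j, c j) • ψ := by
  induction n with
  | zero => simp [kprodFin]
  | succ n ih =>
    rw [kprodFin_succ_last, ← Matrix.mulVec_mulVec,
      ih (fun j => A j.castSucc) (fun j => c j.castSucc) (fun j => h _),
      Matrix.mulVec_smul, h, smul_smul, Fin.prod_univ_castSucc]

theorem prod_Iio_castSucc {n : ℕ} (c : Fin (n + 1) → ℂ) (j : Fin n) :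
    ∏ l ∈ Finset.Iio j.castSucc, c l = ∏ l ∈ Finset.Iio j, c l.castSucc := by
  symm
  refine Finset.prod_bij (fun l _ => l.castSucc) ?_ ?_ ?_ ?_
  · intro a ha
    simpa using ha
  · intro a _ b _ hab
    simpa using hab
  · intro b hb
    rw [Finset.mem_Iio] at hb
    have hb1 : (b : ℕ) < j := hb
    exact ⟨⟨b, by omega⟩, by simpa [Fin.lt_def] using hb1, rfl⟩
  · intro a _
    rfl

theorem prod_Iio_last {n : ℕ} (c : Fin (n + 1) → ℂ) :
    ∏ l ∈ Finset.Iio (Fin.last n), c l = ∏ l : Fin n, c l.castSucc := by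
  symm
  refine Finset.prod_bij (fun l _ => l.castSucc) ?_ ?_ ?_ ?_
  · intro a ha
    simp
  · intro a _ b _ hab
    simpa using hab
  · intro b hb
    rw [Finset.mem_Iio] at hb
    have hb1 : (b : ℕ) < n := hb
    exact ⟨⟨b, by omega⟩, by simp, rfl⟩
  · intro a _
    rfl

theorem kprodFin_hasDerivAt {α : Type*} [Fintype α] [DecidableEq α] {n : ℕ} (θ0 : ℝ)
    (A : ℝ → Fin n → Matrix α α ℂ) (Ad : Fin n → Matrix α α ℂ) (c : Fin n → ℂ) (ψ : α → ℂ)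
    (h : ∀ j, (A θ0 j).mulVec ψ = c j • ψ)
    (hd : ∀ j s t, HasDerivAt (fun θ => A θ j s t) (Ad j s t) θ0) (s : α) :
    HasDerivAt (fun θ => (kprodFin (A θ)).mulVec ψ s)
      (∑ j : Fin n, (∏ l ∈ Finset.Iio j, c l) *
        ((kprodFrom (A θ0) ((j : ℕ) + 1) * Ad j).mulVec ψ s)) θ0 := by
  induction n generalizing s with
  | zero => simpa [kprodFin] using hasDerivAt_const θ0 (ψ s)
  | succ n ih =>
    have ih' := ih (fun θ j => A θ j.castSucc) (fun j => Ad j.castSucc) (fun j => c j.castSucc)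
      (fun j => h _) (fun j => hd _)
    have hv := kprodFin_mulVec (fun j : Fin n => A θ0 j.castSucc) (fun j => c j.castSucc) ψ
      (fun j => h _)
    have key : HasDerivAt
        (fun θ => ∑ t, A θ (Fin.last n) s t *
          ((kprodFin (fun j : Fin n => A θ j.castSucc)).mulVec ψ t)) _ θ0 :=
      HasDerivAt.fun_sum (fun t _ => (hd (Fin.last n) s t).mul (ih' t))
    have e1 : (fun θ => (kprodFin (A θ)).mulVec ψ s) = (fun θ => ∑ t, A θ (Fin.last n) s t *
          ((kprodFin (fun j : Fin n => A θ j.castSucc)).mulVec ψ t)) := by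
      funext θ
      rw [kprodFin_succ_last, ← Matrix.mulVec_mulVec]
      rfl
    rw [e1]
    refine key.congr_deriv ?_
    rw [Finset.sum_add_distrib, Fin.sum_univ_castSucc, add_comm]
    congr 1
    · simp only [Finset.mul_sum]
      rw [Finset.sum_comm]
      refine Finset.sum_congr rfl fun j _ => ?_
      rw [prod_Iio_castSucc, Fin.val_castSucc, kprodFrom_succ_last, Matrix.mul_assoc,
        ← Matrix.mulVec_mulVec _ (A θ0 (Fin.last n))]
      conv_rhs => rw [Matrix.mulVec, dotProduct, Finset.mul_sum]
      refine Finset.sum_congr rfl fun t _ => ?_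
      ring
    · rw [hv, prod_Iio_last, Fin.val_last, kprodFrom_length, one_mul, Matrix.mulVec, dotProduct,
        Finset.mul_sum]
      refine Finset.sum_congr rfl fun t _ => ?_
      simp only [Pi.smul_apply, smul_eq_mul]
      ring

theorem outer_mulVec {α : Type*} [Fintype α] (v w : α → ℂ) :
    (outer v v).mulVec w = inn v w • v := by
  funext s
  simp only [Matrix.mulVec, dotProduct, outer, inn, Pi.smul_apply, smul_eq_mul, Finset.sum_mul]
  refine Finset.sum_congr rfl fun t _ => ?_
  ring

theorem inn_smul {α : Type*} [Fintype α] (v w : α → ℂ) (a : ℂ) :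
    inn v (a • w) = a * inn v w := by
  simp only [inn, Pi.smul_apply, smul_eq_mul, Finset.mul_sum]
  refine Finset.sum_congr rfl fun t _ => ?_
  ring

theorem inn_conj {α : Type*} [Fintype α] (v w : α → ℂ) :
    inn w v = conj (inn v w) := by
  simp only [inn, map_sum, map_mul, Complex.conj_conj]
  refine Finset.sum_congr rfl fun t _ => ?_
  ring

theorem inn_self_nsq {α : Type*} [Fintype α] (v : α → ℂ) : inn v v = (nsq v : ℂ) := by
  simp only [inn, nsq, Complex.ofReal_sum, Complex.normSq_eq_conj_mul_self]

theorem nsq_smul {α : Type*} [Fintype α] (v : α → ℂ) (a : ℂ) :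
    nsq (a • v) = Complex.normSq a * nsq v := by
  simp [nsq, Finset.mul_sum, Complex.normSq_mul]

theorem hasDerivAt_normSq {f : ℝ → ℂ} {f' : ℂ} {x : ℝ} (h : HasDerivAt f f' x) :
    HasDerivAt (fun t => Complex.normSq (f t)) (2 * (conj (f x) * f').re) x := by
  have hre : HasDerivAt (fun t => (f t).re) f'.re x :=
    (Complex.reCLM.hasFDerivAt.comp_hasDerivAt x h)
  have him : HasDerivAt (fun t => (f t).im) f'.im x :=
    (Complex.imCLM.hasFDerivAt.comp_hasDerivAt x h)
  have := (hre.mul hre).add (him.mul him)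
  refine (this.congr_deriv ?_)
  simp
  ring

/-- Pointwise score identity for one outcome. -/
theorem score_pointwise {D n : ℕ} (θ0 : ℝ)
    (A : ℝ → Fin n → Matrix (Fin D) (Fin D) ℂ) (Ad : Fin n → Matrix (Fin D) (Fin D) ℂ)
    (c : Fin n → ℂ) (hc0 : ∀ j, c j ≠ 0) (ψ v : Fin D → ℂ) (hD : (D : ℝ) ≠ 0)
    (hv : inn v v = 1) (hvψ : Complex.normSq (inn v ψ) = 1 / D)
    (h : ∀ j, (A θ0 j).mulVec ψ = c j • ψ)
    (hd : ∀ j s t, HasDerivAt (fun θ => A θ j s t) (Ad j s t) θ0)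
    (Q : ℝ → ℝ) (hQ : ∀ θ, Q θ = nsq ((outer v v).mulVec ((kprodFin (A θ)).mulVec ψ)))
    (Qd : ℝ) (hQd : HasDerivAt Q Qd θ0) :
    Q θ0 ≠ 0 ∧ Qd = Q θ0 * (2 * D * (∑ j : Fin n,
      inn ψ ((outer v v * kprodFrom (A θ0) ((j : ℕ) + 1) * Ad j).mulVec ψ)
        / ∏ l ∈ Finset.Ici j, c l).re) := by
  have hn : nsq v = 1 := by
    have := inn_self_nsq v
    rw [hv] at this
    exact_mod_cast this.symm
  have hQ' : Q = fun θ => Complex.normSq (inn v ((kprodFin (A θ)).mulVec ψ)) := by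
    funext θ
    rw [hQ, outer_mulVec, nsq_smul, hn, mul_one]
  have ha0 : inn v ((kprodFin (A θ0)).mulVec ψ) = (∏ j, c j) * inn v ψ := by
    rw [kprodFin_mulVec _ c ψ h, inn_smul]
  have hC : (∏ j, c j) ≠ 0 := Finset.prod_ne_zero_iff.mpr fun j _ => hc0 j
  have hQ0 : Q θ0 = Complex.normSq (∏ j, c j) * (1 / D) := by
    rw [hQ']
    simp only [ha0, Complex.normSq_mul, hvψ]
  refine ⟨?_, ?_⟩
  · rw [hQ0]
    exact mul_ne_zero (fun h0 => hC (Complex.normSq_eq_zero.mp h0)) (one_div_ne_zero hD)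
  have hder : HasDerivAt (fun θ => inn v ((kprodFin (A θ)).mulVec ψ))
      (∑ j : Fin n, (∏ l ∈ Finset.Iio j, c l) *
        inn v ((kprodFrom (A θ0) ((j : ℕ) + 1) * Ad j).mulVec ψ)) θ0 := by
    have : HasDerivAt (fun θ => inn v ((kprodFin (A θ)).mulVec ψ)) _ θ0 :=
      HasDerivAt.fun_sum (fun s _ =>
        (kprodFin_hasDerivAt θ0 A Ad c ψ h hd s).const_mul (conj (v s)))
    refine this.congr_deriv ?_
    simp only [inn, Finset.mul_sum]
    rw [Finset.sum_comm]
    refine Finset.sum_congr rfl fun j _ => Finset.sum_congr rfl fun s _ => ?_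
    ring
  have h2 := hasDerivAt_normSq hder
  rw [← hQ'] at h2
  rw [hQd.unique h2, ha0, hQ0]
  have hsum : conj ((∏ j, c j) * inn v ψ) * (∑ j : Fin n, (∏ l ∈ Finset.Iio j, c l) *
        inn v ((kprodFrom (A θ0) ((j : ℕ) + 1) * Ad j).mulVec ψ)) =
      (Complex.normSq (∏ j, c j) : ℂ) * ∑ j : Fin n,
      inn ψ ((outer v v * kprodFrom (A θ0) ((j : ℕ) + 1) * Ad j).mulVec ψ)
        / ∏ l ∈ Finset.Ici j, c l := by
    rw [Finset.mul_sum, Finset.mul_sum]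
    refine Finset.sum_congr rfl fun j _ => ?_
    have hI : (∏ l ∈ Finset.Ici j, c l) ≠ 0 := Finset.prod_ne_zero_iff.mpr fun j _ => hc0 j
    have hsplit : (∏ l, c l) = (∏ l ∈ Finset.Iio j, c l) * ∏ l ∈ Finset.Ici j, c l := by
      rw [← Finset.prod_union]
      · congr 1
        ext l
        simp [lt_or_ge]
      · rw [Finset.disjoint_left]
        intro a ha hb
        simp at ha hb
        exact absurd ha (not_lt.mpr hb)
    rw [Matrix.mul_assoc, ← Matrix.mulVec_mulVec _ (outer v v), outer_mulVec, inn_smul, inn_conj v ψ,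
      Complex.normSq_eq_conj_mul_self, map_mul]
    rw [mul_div_assoc', eq_div_iff hI]
    conv_rhs => rw [hsplit]
    conv_lhs => rw [hsplit]
    ring
  rw [hsum, Complex.re_ofReal_mul]
  field_simp

/-- classical Fisher information of the full record, including a final
rank-one projective measurement of the system with `|⟨e^s_{i₀}, ψ⟩|² = 1/D`:
it equals `∑ p f̃²` with
`f̃(𝐢,i₀) = 2D Re ∑ⱼ ⟨ψ|P_{i₀} K_{iₙ}⋯K_{i_{j+1}} K̇_{i_j}|ψ⟩ / (c_{i_j}⋯c_{iₙ})`. -/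
theorem full_CFI_sampling_formula
    (D k n : ℕ) (θ0 : ℝ)
    (W : ℝ → Matrix (Fin D × Fin k) (Fin D × Fin k) ℂ)
    (hWu : ∀ θ, W θ ∈ Matrix.unitaryGroup (Fin D × Fin k) ℂ)
    (Wd : Matrix (Fin D × Fin k) (Fin D × Fin k) ℂ)
    (hWd : ∀ x y, HasDerivAt (fun θ => W θ x y) (Wd x y) θ0)
    (ψ : Fin D → ℂ) (χ : Fin k → ℂ) (hψ : nsq ψ = 1) (hχ : nsq χ = 1)
    (hstat : (W θ0).mulVec (vtens ψ χ) = vtens ψ χ)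
    -- adaptive measurement bases for the output units
    (e : Fin n → (Fin n → Fin k) → Fin k → Fin k → ℂ)
    (hadapt : ∀ (j : Fin n) (g g' : Fin n → Fin k),
      (∀ l : Fin n, l < j → g l = g' l) → e j g = e j g')
    (honb : ∀ (j : Fin n) (g : Fin n → Fin k) (i i' : Fin k),
      inn (e j g i) (e j g i') = if i = i' then 1 else 0)
    (hchi0 : ∀ (j : Fin n) (g : Fin n → Fin k) (i : Fin k), inn (e j g i) χ ≠ 0)
    (c : (Fin n → Fin k) → Fin n → ℂ)
    (hc : ∀ g (j : Fin n), c g j = inn (e j g (g j)) χ)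
    (hKψ : ∀ g (j : Fin n),
      (kraus (W θ0) (e j g (g j)) χ).mulVec ψ = c g j • ψ)
    (Kd : (Fin n → Fin k) → Fin n → Matrix (Fin D) (Fin D) ℂ)
    (hKd : ∀ g (j : Fin n) s t,
      HasDerivAt (fun θ => kraus (W θ) (e j g (g j)) χ s t) (Kd g j s t) θ0)
    -- final rank-one projective measurement on the system ℂ^D
    (es : (Fin n → Fin k) → Fin D → Fin D → ℂ)
    (honbs : ∀ (g : Fin n → Fin k) (i i' : Fin D),
      inn (es g i) (es g i') = if i = i' then 1 else 0)
    (hesψ : ∀ (g : Fin n → Fin k) (i0 : Fin D),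
      Complex.normSq (inn (es g i0) ψ) = 1 / D)
    -- the augmented likelihood and its derivative at θ0
    (q : ℝ → (Fin n → Fin k) → Fin D → ℝ)
    (hq : ∀ θ g i0, q θ g i0 =
      nsq ((outer (es g i0) (es g i0)).mulVec
        ((kprodFin fun j : Fin n => kraus (W θ) (e j g (g j)) χ).mulVec ψ)))
    (qd : (Fin n → Fin k) → Fin D → ℝ)
    (hqd : ∀ g i0, HasDerivAt (fun θ => q θ g i0) (qd g i0) θ0) :
    (∑ x ∈ Finset.univ.filter
        (fun x : (Fin n → Fin k) × Fin D => q θ0 x.1 x.2 ≠ 0),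
      (q θ0 x.1 x.2)⁻¹ * (qd x.1 x.2) ^ 2)
      = ∑ g : Fin n → Fin k, ∑ i0 : Fin D, q θ0 g i0 *
          (2 * D * (∑ j : Fin n,
            inn ψ (((outer (es g i0) (es g i0)
                      * kprodFrom (fun l : Fin n => kraus (W θ0) (e l g (g l)) χ) ((j : ℕ) + 1)
                      * Kd g j).mulVec ψ))
              / ∏ l ∈ Finset.Ici j, c g l).re) ^ 2 := by
  have hpt : ∀ g i0, q θ0 g i0 ≠ 0 ∧ qd g i0 = q θ0 g i0 * (2 * D * (∑ j : Fin n,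
            inn ψ (((outer (es g i0) (es g i0)
                      * kprodFrom (fun l : Fin n => kraus (W θ0) (e l g (g l)) χ) ((j : ℕ) + 1)
                      * Kd g j).mulVec ψ))
              / ∏ l ∈ Finset.Ici j, c g l).re) := by
    intro g i0
    have hD : (D : ℝ) ≠ 0 := by
      have := i0.pos
      positivity
    exact score_pointwise θ0 (fun θ j => kraus (W θ) (e j g (g j)) χ) (Kd g) (c g)
      (fun j => by rw [hc]; exact hchi0 _ _ _) ψ (es g i0) hD (by simpa using honbs g i0 i0)
      (hesψ g i0) (hKψ g) (hKd g) (fun θ => q θ g i0) (fun θ => hq θ g i0) _ (hqd g i0)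
  rw [Finset.filter_true_of_mem (fun x _ => (hpt x.1 x.2).1), Fintype.sum_prod_type]
  refine Finset.sum_congr rfl fun g _ => Finset.sum_congr rfl fun i0 _ => ?_
  obtain ⟨h0, h1⟩ := hpt g i0
  rw [h1, mul_pow, pow_two (q θ0 g i0), mul_assoc, inv_mul_cancel_left₀ h0]
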